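/- Let i be a nonnegative integer and let α, β be complex numbers with β ≠ 0. Assume that (β)_{m+n} and (α/2)_n are nonzero for all nonnegative integers m, n, that no argument of Γ appearing on the right-hand side below is a nonpositive integer, and that the double series defining the Kampé de Fériet function converges absolutely. Then F^{1:1;2}_{1:0;1}[α : β/2+2+i ; β/2−2−i, α/2+1 ; β : — ; α/2 ; 1/2, 1/2] = ((−1)^i · 2^{α+3+i}) / (β · (i+1)!) · Σ_{r=0}^{i} (−1)^r · C(i,r) · Γ(β/4+(r+1)/2) / Γ(β/4−i+(r−1)/2). -/

import Mathlib

open Complex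

noncomputable section

/-- Pochhammer symbol `(a)_n = a (a+1) ⋯ (a+n-1)`. -/
def poch (a : ℂ) (n : ℕ) : ℂ := ∏ k ∈ Finset.range n, (a + k)

/-- `z` is not a nonpositive integer. -/
def notNonposInt (z : ℂ) : Prop := ∀ n : ℕ, z ≠ -(n : ℂ)

/-- Term of the Kampé de Fériet double series `F^{1:1;2}_{1:0;1}`. -/
def kdfTerm (α ε b₁ b₂ β d₁ x y : ℂ) (p : ℕ × ℕ) : ℂ :=
  poch α (p.1 + p.2) * poch ε p.1 * poch b₁ p.2 * poch b₂ p.2 /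
    (poch β (p.1 + p.2) * poch d₁ p.2) * x ^ p.1 * y ^ p.2 /
    ((p.1.factorial : ℂ) * (p.2.factorial : ℂ))

theorem poch_eq_ascPochhammer_eval (a : ℂ) (n : ℕ) : poch a n = (ascPochhammer ℂ n).eval a := by
  induction n with
  | zero => simp [poch]
  | succ n ih => rw [ascPochhammer_succ_eval, ← ih, poch, poch, Finset.prod_range_succ]

theorem poch_eq_factorial_mul_multichoose (a : ℂ) (n : ℕ) :
    poch a n = n.factorial * Ring.multichoose a n := by
  rw [poch_eq_ascPochhammer_eval, ← Polynomial.ascPochhammer_smeval_eq_eval,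
    ← Ring.factorial_nsmul_multichoose_eq_ascPochhammer, nsmul_eq_mul]

theorem poch_succ_left (a : ℂ) (n : ℕ) : poch a (n + 1) = a * poch (a + 1) n := by
  rw [poch, poch, Finset.prod_range_succ', mul_comm]
  congr 1
  · simp
  · exact Finset.prod_congr rfl fun k _ => by push_cast; ring

theorem poch_succ_right (a : ℂ) (n : ℕ) : poch a (n + 1) = poch a n * (a + n) := by
  rw [poch, poch, Finset.prod_range_succ]

theorem mul_poch_add_one (a : ℂ) (n : ℕ) : a * poch (a + 1) n = poch a n * (a + n) := by
  rw [← poch_succ_left, poch_succ_right]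

theorem succ_mul_multichoose_succ (a : ℂ) (n : ℕ) :
    ((n : ℂ) + 1) * Ring.multichoose a (n + 1) = a * Ring.multichoose (a + 1) n := by
  have h := poch_succ_left a n
  rw [poch_eq_factorial_mul_multichoose, poch_eq_factorial_mul_multichoose,
    Nat.factorial_succ] at h
  push_cast at h
  have hn : (n.factorial : ℂ) ≠ 0 := by exact_mod_cast n.factorial_ne_zero
  exact mul_left_cancel₀ hn (by linear_combination h)

/-- The Chu-Vandermonde identity for `Ring.multichoose`. -/
theorem sum_antidiagonal_multichoose (a b : ℂ) (n : ℕ) :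
    ∑ p ∈ Finset.HasAntidiagonal.antidiagonal n, Ring.multichoose a p.1 * Ring.multichoose b p.2 =
      Ring.multichoose (a + b) n := by
  have key : ∀ (c : ℂ) (k : ℕ), Ring.multichoose c k = (-1) ^ k * Ring.choose (-c) k := by
    intro c k
    rw [Ring.choose_neg', Units.smul_def, Int.coe_negOnePow_natCast, zsmul_eq_mul]
    push_cast
    rw [← mul_assoc, ← mul_pow]
    simp
  rw [key, neg_add, Ring.add_choose_eq n (Commute.all _ _), Finset.mul_sum]
  refine Finset.sum_congr rfl fun p hp => ?_
  rw [key a, key b, ← Finset.HasAntidiagonal.mem_antidiagonal.mp hp, pow_add]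
  ring

theorem sum_antidiagonal_snd_mul_multichoose (a b : ℂ) (n : ℕ) :
    ∑ p ∈ Finset.HasAntidiagonal.antidiagonal (n + 1),
      (p.2 : ℂ) * (Ring.multichoose a p.1 * Ring.multichoose b p.2) =
      b * Ring.multichoose (a + b + 1) n := by
  rw [Finset.Nat.sum_antidiagonal_succ', add_assoc a, ← sum_antidiagonal_multichoose,
    Finset.mul_sum]
  simp only [Nat.cast_zero, zero_mul, zero_add]
  refine Finset.sum_congr rfl fun p _ => ?_
  push_cast
  linear_combination Ring.multichoose a p.1 * succ_mul_multichoose_succ b p.2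

theorem mul_sum_antidiagonal_snd_mul_multichoose (a b : ℂ) (n : ℕ) :
    (a + b) * ∑ p ∈ Finset.HasAntidiagonal.antidiagonal n,
      (p.2 : ℂ) * (Ring.multichoose a p.1 * Ring.multichoose b p.2) =
      n * b * Ring.multichoose (a + b) n := by
  cases n with
  | zero => simp
  | succ n =>
    rw [sum_antidiagonal_snd_mul_multichoose]
    push_cast
    linear_combination -b * succ_mul_multichoose_succ (a + b) n

theorem hasSum_multichoose_half (a : ℂ) :
    HasSum (fun n : ℕ => Ring.multichoose a n * (1 / 2 : ℂ) ^ n) (2 ^ a) := by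
  have h := (one_div_one_sub_cpow_hasFPowerSeriesOnBall_zero a).hasSum
    (y := (1 / 2 : ℂ)) (by
      rw [← ENNReal.ofReal_one, Metric.eball_ofReal]
      norm_num)
  have hv : (1 : ℂ) / (1 - (0 + 1 / 2)) ^ a = 2 ^ a := by
    have : (1 - (0 + 1 / 2) : ℂ) = 2⁻¹ := by norm_num
    rw [this, inv_cpow _ _ (by
      rw [show (2 : ℂ) = ((2 : ℝ) : ℂ) by norm_num, arg_ofReal_of_nonneg (by norm_num)]
      exact Real.pi_pos.ne), one_div, inv_inv]
  rw [hv] at h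
  simpa only [FormalMultilinearSeries.ofScalars_apply_eq, ← Ring.multichoose_eq,
    smul_eq_mul] using h

theorem hasSum_natCast_mul_multichoose_half (a : ℂ) :
    HasSum (fun n : ℕ => (n : ℂ) * (Ring.multichoose a n * (1 / 2 : ℂ) ^ n)) (a * 2 ^ a) := by
  rw [← hasSum_nat_add_iff' 1]
  have h := (hasSum_multichoose_half (a + 1)).mul_left (a / 2)
  rw [cpow_add _ _ two_ne_zero, cpow_one] at h
  have hf : (fun n : ℕ => ((n + 1 : ℕ) : ℂ) *
      (Ring.multichoose a (n + 1) * (1 / 2 : ℂ) ^ (n + 1))) =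
      fun n => a / 2 * (Ring.multichoose (a + 1) n * (1 / 2) ^ n) := by
    funext n
    push_cast
    rw [pow_succ]
    linear_combination (1 / 2 : ℂ) ^ n / 2 * succ_mul_multichoose_succ a n
  rw [hf, show a * 2 ^ a - ∑ n ∈ Finset.range 1,
    (n : ℂ) * (Ring.multichoose a n * (1 / 2 : ℂ) ^ n) = a / 2 * (2 ^ a * 2) by simp; ring]
  exact h

theorem sum_antidiagonal_kdfTerm {α ε b β : ℂ} (hα : ∀ n : ℕ, poch (α / 2) n ≠ 0)
    (hβ : ∀ n : ℕ, poch β n ≠ 0) (hε : ε + b = β) (N : ℕ) :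
    ∑ p ∈ Finset.HasAntidiagonal.antidiagonal N,
      kdfTerm α ε b (α / 2 + 1) β (α / 2) (1 / 2) (1 / 2) p =
      Ring.multichoose α N * (1 / 2) ^ N +
        2 * b / (α * β) * (N * (Ring.multichoose α N * (1 / 2) ^ N)) := by
  have hα0 : α ≠ 0 := by
    rintro rfl
    exact hα 1 (by simp [poch])
  have hβ0 : β ≠ 0 := by
    rintro rfl
    exact hβ 1 (by simp [poch])
  have hfac : ∀ n : ℕ, (n.factorial : ℂ) ≠ 0 := fun n => by exact_mod_cast n.factorial_ne_zero
  have hterm : ∀ p ∈ Finset.HasAntidiagonal.antidiagonal N,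
      kdfTerm α ε b (α / 2 + 1) β (α / 2) (1 / 2) (1 / 2) p =
        poch α N / poch β N * (1 / 2) ^ N *
          (Ring.multichoose ε p.1 * Ring.multichoose b p.2) +
        poch α N / poch β N * (1 / 2) ^ N * (2 / α) *
          (p.2 * (Ring.multichoose ε p.1 * Ring.multichoose b p.2)) := by
    intro p hp
    have hq : poch (α / 2 + 1) p.2 = poch (α / 2) p.2 * (1 + 2 / α * p.2) := by
      refine mul_left_cancel₀ (div_ne_zero hα0 two_ne_zero) ?_
      rw [mul_poch_add_one]
      field_simp
    have hpN : p.1 + p.2 = N := Finset.HasAntidiagonal.mem_antidiagonal.mp hp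
    rw [kdfTerm, hq, ← hpN, pow_add, hpN, poch_eq_factorial_mul_multichoose ε,
      poch_eq_factorial_mul_multichoose b]
    have h1 := hα p.2
    have h2 := hβ N
    have h3 := hfac p.1
    have h4 := hfac p.2
    field_simp
  rw [Finset.sum_congr rfl hterm, Finset.sum_add_distrib, ← Finset.mul_sum, ← Finset.mul_sum,
    sum_antidiagonal_multichoose, hε]
  have hm := mul_sum_antidiagonal_snd_mul_multichoose ε b N
  rw [hε] at hm
  rw [eq_div_of_mul_eq hβ0 ((mul_comm _ _).trans hm), poch_eq_factorial_mul_multichoose α]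
  have hN := hβ N
  have hb := poch_eq_factorial_mul_multichoose β N
  field_simp
  rw [hb]
  ring

theorem tsum_kdfTerm {α ε b β : ℂ} (hα : ∀ n : ℕ, poch (α / 2) n ≠ 0)
    (hβ : ∀ n : ℕ, poch β n ≠ 0) (hε : ε + b = β)
    (hsum : Summable (kdfTerm α ε b (α / 2 + 1) β (α / 2) (1 / 2) (1 / 2))) :
    ∑' p, kdfTerm α ε b (α / 2 + 1) β (α / 2) (1 / 2) (1 / 2) p =
      2 ^ α * (1 + 2 * b / β) := by
  have hα0 : α ≠ 0 := by
    rintro rfl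
    exact hα 1 (by simp [poch])
  have e := (Finset.HasAntidiagonal.sigmaAntidiagonalEquivProd (A := ℕ)).hasSum_iff.mpr hsum.hasSum
  have h := e.sigma fun N => hasSum_fintype _
  have h' := (hasSum_multichoose_half α).add
    ((hasSum_natCast_mul_multichoose_half α).mul_left (2 * b / (α * β)))
  rw [show (2 : ℂ) ^ α * (1 + 2 * b / β) = 2 ^ α + 2 * b / (α * β) * (α * 2 ^ α) by
    field_simp]
  refine h.unique ?_
  convert h' using 1
  funext N
  rw [← sum_antidiagonal_kdfTerm hα hβ hε N]
  exact Finset.sum_coe_sort (Finset.HasAntidiagonal.antidiagonal N)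
    (kdfTerm α ε b (α / 2 + 1) β (α / 2) (1 / 2) (1 / 2))

/-- The alternating binomial sum `∑ (-1)^r C(i,r) ∏ (u k + r)`. -/
def altSum (i n : ℕ) (u : ℕ → ℂ) : ℂ :=
  ∑ r ∈ Finset.range (i + 1), (-1 : ℂ) ^ r * (i.choose r : ℂ) * ∏ k ∈ Finset.range n, (u k + r)

theorem altSum_zero_left (n : ℕ) (u : ℕ → ℂ) : altSum 0 n u = ∏ k ∈ Finset.range n, u k := by
  simp [altSum]

theorem altSum_succ_zero (i : ℕ) (u : ℕ → ℂ) : altSum (i + 1) 0 u = 0 := by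
  have h := Int.alternating_sum_range_choose_of_ne (n := i + 1) (Nat.succ_ne_zero i)
  have h' := congrArg (Int.cast : ℤ → ℂ) h
  push_cast at h'
  simpa [altSum] using h'

theorem altSum_succ_succ (i n : ℕ) (u : ℕ → ℂ) :
    altSum (i + 1) (n + 1) u =
      u n * altSum (i + 1) n u - (i + 1) * altSum i n fun k => u k + 1 := by
  have hsplit : altSum (i + 1) (n + 1) u = u n * altSum (i + 1) n u +
      ∑ r ∈ Finset.range (i + 1 + 1), (-1 : ℂ) ^ r * ((i + 1).choose r * r : ℂ) *
        ∏ k ∈ Finset.range n, (u k + r) := by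
    rw [altSum, altSum, Finset.mul_sum, ← Finset.sum_add_distrib]
    refine Finset.sum_congr rfl fun r _ => ?_
    rw [Finset.prod_range_succ]
    ring
  rw [hsplit, Finset.sum_range_succ', altSum, altSum, Finset.mul_sum, sub_eq_add_neg,
    Finset.mul_sum, ← Finset.sum_neg_distrib]
  congr 1
  simp only [Nat.cast_zero, mul_zero, zero_mul, add_zero]
  refine Finset.sum_congr rfl fun r _ => ?_
  have h : ((i : ℂ) + 1) * i.choose r = (i + 1).choose (r + 1) * (r + 1) := by
    exact_mod_cast Nat.add_one_mul_choose_eq i r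
  have hp : ∏ k ∈ Finset.range n, (u k + ((r + 1 : ℕ) : ℂ)) =
      ∏ k ∈ Finset.range n, (u k + 1 + r) :=
    Finset.prod_congr rfl fun k _ => by push_cast; ring
  rw [hp, pow_succ]
  push_cast
  linear_combination (-1 : ℂ) ^ r * (∏ k ∈ Finset.range n, (u k + 1 + r)) * h

theorem altSum_of_lt {i n : ℕ} (h : n < i) (u : ℕ → ℂ) : altSum i n u = 0 := by
  induction n generalizing i u with
  | zero =>
    obtain ⟨i, rfl⟩ := Nat.exists_eq_succ_of_ne_zero h.ne'
    exact altSum_succ_zero i u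
  | succ n ih =>
    obtain ⟨i, rfl⟩ := Nat.exists_eq_succ_of_ne_zero (Nat.ne_zero_of_lt h)
    rw [Nat.succ_eq_add_one, altSum_succ_succ, ih (by omega), ih (by omega)]
    ring

theorem altSum_self (i : ℕ) (u : ℕ → ℂ) : altSum i i u = (-1) ^ i * i.factorial := by
  induction i generalizing u with
  | zero => simp [altSum_zero_left]
  | succ i ih =>
    rw [altSum_succ_succ, altSum_of_lt (Nat.lt_succ_self i), ih, Nat.factorial_succ, pow_succ]
    push_cast
    ring

theorem altSum_self_succ (i : ℕ) (u : ℕ → ℂ) :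
    altSum i (i + 1) u =
      (-1) ^ i * i.factorial * ((i + 1) * i / 2 + ∑ k ∈ Finset.range (i + 1), u k) := by
  induction i generalizing u with
  | zero => simp [altSum_zero_left]
  | succ i ih =>
    rw [altSum_succ_succ, altSum_self, ih, Nat.factorial_succ, pow_succ, Finset.sum_add_distrib,
      Finset.sum_range_succ _ (i + 1)]
    simp only [Finset.sum_const, Finset.card_range, nsmul_eq_mul]
    push_cast
    ring

theorem sum_alternating_Gamma_div_Gamma (i : ℕ) (c : ℂ)
    (hc : ∀ r : ℕ, r ≤ i → notNonposInt (c + r / 2)) :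
    ∑ r ∈ Finset.range (i + 1), (-1 : ℂ) ^ r * (i.choose r : ℂ) *
        Gamma (c + r / 2 + (i + 1 : ℕ)) / Gamma (c + r / 2) =
      (-1) ^ i * (i + 1).factorial / 2 ^ (i + 1) * (2 * c + 3 * i / 2) := by
  have h := altSum_self_succ i fun k => 2 * (c + k)
  have hS : ∑ k ∈ Finset.range (i + 1), 2 * (c + (k : ℂ)) = (i + 1) * (2 * c + i) := by
    clear hc h
    induction i with
    | zero => simp
    | succ i ih => rw [Finset.sum_range_succ, ih]; push_cast; ring
  rw [hS] at h
  have hterm : ∀ r ∈ Finset.range (i + 1), (-1 : ℂ) ^ r * (i.choose r : ℂ) *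
      Gamma (c + r / 2 + (i + 1 : ℕ)) / Gamma (c + r / 2) =
      1 / 2 ^ (i + 1) * ((-1 : ℂ) ^ r * (i.choose r : ℂ) *
        ∏ k ∈ Finset.range (i + 1), (2 * (c + (k : ℂ)) + r)) := by
    intro r hr
    have hp : ∏ k ∈ Finset.range (i + 1), (2 * (c + (k : ℂ)) + r) =
        2 ^ (i + 1) * poch (c + r / 2) (i + 1) := by
      rw [poch, ← Finset.card_range (i + 1), ← Finset.prod_const, Finset.card_range,
        ← Finset.prod_mul_distrib]
      exact Finset.prod_congr rfl fun k _ => by ring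
    rw [mul_div_assoc, Gamma_add_nat_div_Gamma_eq _ (hc r (by simpa [Nat.lt_succ_iff] using hr)),
      ← poch_eq_ascPochhammer_eval, hp]
    field_simp
  rw [Finset.sum_congr rfl hterm, ← Finset.mul_sum]
  rw [altSum] at h
  rw [h, Nat.factorial_succ]
  push_cast
  ring

theorem stmt_6 (i : ℕ) (α β : ℂ)
    (hβ0 : β ≠ 0)
    (hβ : ∀ m n : ℕ, poch β (m + n) ≠ 0)
    (hd : ∀ n : ℕ, poch (α / 2) n ≠ 0)
    (hΓs : ∀ r : ℕ, r ≤ i →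
      notNonposInt (β / 4 + ((r : ℂ) + 1) / 2) ∧ notNonposInt (β / 4 - (i : ℂ) + ((r : ℂ) - 1) / 2))
    (hsum : Summable fun p : ℕ × ℕ => ‖kdfTerm α (β / 2 + 2 + (i : ℂ)) (β / 2 - 2 - (i : ℂ)) (α / 2 + 1) β (α / 2) (1/2) (1/2) p‖) :
    (∑' p : ℕ × ℕ, kdfTerm α (β / 2 + 2 + (i : ℂ)) (β / 2 - 2 - (i : ℂ)) (α / 2 + 1) β (α / 2) (1/2) (1/2) p) =
      (-1 : ℂ) ^ i * (2 : ℂ) ^ (α + 3 + (i : ℂ)) / (β * ((i + 1).factorial : ℂ)) *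
      ∑ r ∈ Finset.range (i + 1), (-1 : ℂ) ^ r * (i.choose r : ℂ) *
        Gamma (β / 4 + ((r : ℂ) + 1) / 2) /
        Gamma (β / 4 - (i : ℂ) + ((r : ℂ) - 1) / 2) := by
  rw [tsum_kdfTerm hd (fun n => by simpa using hβ 0 n) (by ring) hsum.of_norm]
  have hG := sum_alternating_Gamma_div_Gamma i (β / 4 - i - 1 / 2) fun r hr => by
    have := (hΓs r hr).2
    rwa [show β / 4 - i - 1 / 2 + (r : ℂ) / 2 = β / 4 - i + ((r : ℂ) - 1) / 2 by ring]
  have hR : ∑ r ∈ Finset.range (i + 1), (-1 : ℂ) ^ r * (i.choose r : ℂ) *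
        Gamma (β / 4 + ((r : ℂ) + 1) / 2) / Gamma (β / 4 - (i : ℂ) + ((r : ℂ) - 1) / 2) =
      (-1) ^ i * (i + 1).factorial / 2 ^ (i + 1) * (2 * (β / 4 - i - 1 / 2) + 3 * i / 2) := by
    rw [← hG]
    refine Finset.sum_congr rfl fun r _ => ?_
    congr 2
    · congr 1
      push_cast
      ring
    · ring
  have hpow : (2 : ℂ) ^ (α + 3 + (i : ℂ)) = 2 ^ α * 2 ^ 3 * 2 ^ i := by
    rw [cpow_add _ _ two_ne_zero, cpow_add _ _ two_ne_zero, cpow_natCast]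
    congr 2
    exact_mod_cast cpow_natCast 2 3
  have hfac : ((i + 1).factorial : ℂ) ≠ 0 := by exact_mod_cast (i + 1).factorial_ne_zero
  have hsq : ((-1 : ℂ) ^ i) * (-1) ^ i = 1 := by rw [← mul_pow]; simp
  rw [hR, hpow, pow_succ (2 : ℂ) i]
  field_simp
  linear_combination (-8 * (β - 2 - i)) * hsq
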